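/- arXiv:1212.5106 — 3 statements merged into one kernel-verified Lean document; each statement's English description precedes it below -/
import Mathlib

section
/- Let X be the set consisting of the words 1121, 1122, 12121, 12122 over {1,2,3} together with all words obtained from these by permuting the letters 1, 2, 3. If ω is an Arnoux-Rauzy word over {1,2,3} whose directive sequence (i_m) contains no factor belonging to X, then ω is 2-balanced. -/
/-- The Arnoux-Rauzy substitution `σ_i : i ↦ i, j ↦ j i` for `j ≠ i`,
extended to words. Letters 1,2,3 are represented by `0,1,2 : Fin 3`. -/
def sigmaSub {A : Type*} [DecidableEq A] (i : A) (w : List A) : List A :=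
  w.flatMap fun j => if j = i then [i] else [j, i]

/-- `ARword dir n = σ_{i₀} σ_{i₁} ⋯ σ_{i_{n-1}} (1)` for the directive
sequence `dir`, where the letter `1` is represented by `0 : Fin 3`. -/
def ARword (dir : ℕ → Fin 3) (n : ℕ) : List (Fin 3) :=
  ((List.range n).map dir).foldr sigmaSub [0]

/-- `u` is a factor of the infinite word `ω`. -/
def FactorOf {A : Type*} (ω : ℕ → A) (u : List A) : Prop :=
  ∃ k, u = (List.range u.length).map fun t => ω (k + t)

/-- `ω` is an Arnoux-Rauzy word with directive sequence `dir`: every letter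
occurs infinitely often in `dir`, and the factors of `ω` are exactly the
factors of the words `σ_{i₀} ⋯ σ_{i_{n-1}}(1)`. -/
def IsAR (ω : ℕ → Fin 3) (dir : ℕ → Fin 3) : Prop :=
  (∀ a : Fin 3, ∀ m : ℕ, ∃ n, m ≤ n ∧ dir n = a) ∧
  (∀ u : List (Fin 3), FactorOf ω u ↔ ∃ n, u <:+: ARword dir n)

/-- `ω` is `C`-balanced: any two factors of equal length have all letter-count
differences bounded by `C` in absolute value. -/
def IsBalanced {A : Type*} [DecidableEq A] (C : ℕ) (ω : ℕ → A) : Prop :=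
  ∀ u v : List A, FactorOf ω u → FactorOf ω v → u.length = v.length →
    ∀ j : A, |(u.count j : ℤ) - v.count j| ≤ C

/-- The forbidden patterns: `1121, 1122, 12121, 12122` (with letters 1,2,3
written as `0,1,2 : Fin 3`) and their images under permutations of letters. -/
def ForbiddenPatterns : Set (List (Fin 3)) :=
  {w | ∃ π : Equiv.Perm (Fin 3),
    w ∈ ([[0, 0, 1, 0], [0, 0, 1, 1], [0, 1, 0, 1, 0], [0, 1, 0, 1, 1]] :
      List (List (Fin 3))).map (List.map π)}

/-- strongly mixed signs -/
def M3 (p l c : ℤ) : Prop := (3 ≤ p ∨ 3 ≤ l ∨ 3 ≤ c) ∧ (p ≤ -3 ∨ l ≤ -3 ∨ c ≤ -3)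

def Tab (p l c : ℤ) : Prop :=
  (c = 2 ∧ p ≤ -3 ∧ 0 ≤ l ∧ l ≤ 2) ∨ (c = 2 ∧ l ≤ -3 ∧ 0 ≤ p ∧ p ≤ 2) ∨
  (p = 2 ∧ l ≤ -3 ∧ 1 ≤ c ∧ c ≤ 2) ∨ (p = 2 ∧ c ≤ -3 ∧ 0 ≤ l ∧ l ≤ 2) ∨
  (l = 2 ∧ p ≤ -3 ∧ 1 ≤ c ∧ c ≤ 2) ∨ (l = 2 ∧ c ≤ -3 ∧ 1 ≤ p ∧ p ≤ 2)

def Taba (p l c : ℤ) : Prop :=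
  (c = 2 ∧ p ≤ -3 ∧ l ≤ 2) ∨ (c = 2 ∧ l ≤ -3 ∧ 0 ≤ p ∧ p ≤ 2) ∨
  (p = 2 ∧ l ≤ -3 ∧ 1 ≤ c ∧ c ≤ 2) ∨ (p = 2 ∧ c ≤ -3 ∧ 0 ≤ l ∧ l ≤ 2) ∨
  (l = 2 ∧ p ≤ -3 ∧ 1 ≤ c ∧ c ≤ 2) ∨ (l = 2 ∧ c ≤ -3 ∧ 1 ≤ p ∧ p ≤ 2)

def Taa (p l c : ℤ) : Prop :=
  (c = 2 ∧ p ≤ -3 ∧ l ≤ 2) ∨ (c = 2 ∧ l ≤ -3 ∧ 0 ≤ p ∧ p ≤ 2) ∨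
  (p = 2 ∧ c ≤ -3 ∧ l ≤ 2) ∨ (p = 2 ∧ l ≤ -3 ∧ 0 ≤ c ∧ c ≤ 2) ∨
  (l = 2 ∧ p ≤ -3 ∧ 1 ≤ c ∧ c ≤ 2) ∨ (l = 2 ∧ c ≤ -3 ∧ 1 ≤ p ∧ p ≤ 2)

def TF (p l c : ℤ) : Prop :=
  (c = 2 ∧ p ≤ -3 ∧ l ≤ 2) ∨ (c = 2 ∧ l ≤ -3 ∧ p ≤ 2) ∨
  (p = 2 ∧ l ≤ -3 ∧ 1 ≤ c ∧ c ≤ 2) ∨ (p = 2 ∧ c ≤ -3 ∧ 0 ≤ l ∧ l ≤ 2) ∨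
  (l = 2 ∧ p ≤ -3 ∧ 1 ≤ c ∧ c ≤ 2) ∨ (l = 2 ∧ c ≤ -2 ∧ 1 ≤ p ∧ p ≤ 2) ∨
  (p = 2 ∧ c = -2 ∧ 1 ≤ l ∧ l ≤ 2)

def Pm (T : ℤ → ℤ → ℤ → Prop) (p l c : ℤ) : Prop := M3 p l c ∨ T p l c ∨ T (-p) (-l) (-c)


theorem m3_step (p l c e : ℤ) (h : M3 p l c) (h1 : -2 ≤ e) (h2 : e ≤ 2) :
    M3 p (l - p - c - e) c ∨
      (l - p - c - e = 2 ∧ (p = 2 ∧ c = -3 ∨ p = -3 ∧ c = 2)) ∨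
      (l - p - c - e = -2 ∧ (p = -2 ∧ c = 3 ∨ p = 3 ∧ c = -2)) := by
  obtain ⟨h3 | h3 | h3, h4 | h4 | h4⟩ := h <;> unfold M3 <;> omega

theorem m3_perm (p l c : ℤ) (h : M3 p l c) : M3 l p c ∧ M3 l c p ∧ M3 c l p := by
  unfold M3 at *
  tauto

theorem Pm_neg (T : ℤ → ℤ → ℤ → Prop) (p l c : ℤ) (h : Pm T p l c) :
    Pm T (-p) (-l) (-c) := by
  rcases h with h | h | h
  · left; unfold M3 at *; omega
  · right; right; simpa using h
  · right; left; exact h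

theorem ab_P_aux (p l c e : ℤ) (h : Tab p l c) (h1 : -2 ≤ e) (h2 : e ≤ 2) :
    Pm Taba l (p - l - c - e) c := by
  unfold Tab at h
  unfold Pm M3 Taba
  rcases h with h | h | h | h | h | h <;> obtain rfl | rfl | rfl | rfl | rfl : e = -2 ∨ e = -1 ∨ e = 0 ∨ e = 1 ∨ e = 2 := by omega
  all_goals grind

theorem ab_P (p l c e : ℤ) (h : Pm Tab p l c) (h1 : -2 ≤ e) (h2 : e ≤ 2) :
    Pm Taba l (p - l - c - e) c := by
  rcases h with h | h | h
  · have := m3_step l p c e (m3_perm _ _ _ h).1 h1 h2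
    generalize p - l - c - e = z at *
    rcases this with h | ⟨rfl, ⟨rfl, rfl⟩ | ⟨rfl, rfl⟩⟩ | ⟨rfl, ⟨rfl, rfl⟩ | ⟨rfl, rfl⟩⟩
    · exact Or.inl h
    · right; left; unfold Taba; norm_num
    · right; left; unfold Taba; norm_num
    · right; right; unfold Taba; norm_num
    · right; right; unfold Taba; norm_num
  · exact ab_P_aux p l c e h h1 h2
  · have := ab_P_aux (-p) (-l) (-c) (-e) h (by omega) (by omega)
    have := Pm_neg _ _ _ _ this
    simp only [neg_neg] at this
    convert this using 1
    ring

theorem aba_L_aux (p l c e : ℤ) (h : Taba p l c) (h1 : -2 ≤ e) (h2 : e ≤ 2) :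
    Pm Taa p (l - p - c - e) c := by
  unfold Taba at h
  unfold Pm M3 Taa
  rcases h with h | h | h | h | h | h <;> obtain rfl | rfl | rfl | rfl | rfl : e = -2 ∨ e = -1 ∨ e = 0 ∨ e = 1 ∨ e = 2 := by omega
  all_goals grind

theorem aba_L (p l c e : ℤ) (h : Pm Taba p l c) (h1 : -2 ≤ e) (h2 : e ≤ 2) :
    Pm Taa p (l - p - c - e) c := by
  rcases h with h | h | h
  · have := m3_step p l c e h h1 h2
    generalize l - p - c - e = z at *
    rcases this with h | ⟨rfl, ⟨rfl, rfl⟩ | ⟨rfl, rfl⟩⟩ | ⟨rfl, ⟨rfl, rfl⟩ | ⟨rfl, rfl⟩⟩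
    · exact Or.inl h
    · right; left; unfold Taa; norm_num
    · right; left; unfold Taa; norm_num
    · right; right; unfold Taa; norm_num
    · right; right; unfold Taa; norm_num
  · exact aba_L_aux p l c e h h1 h2
  · have := aba_L_aux (-p) (-l) (-c) (-e) h (by omega) (by omega)
    have := Pm_neg _ _ _ _ this
    simp only [neg_neg] at this
    convert this using 1
    ring

theorem aba_P_aux (p l c e : ℤ) (h : Taba p l c) (h1 : -2 ≤ e) (h2 : e ≤ 2) :
    Pm TF l (p - l - c - e) c := by
  unfold Taba at h
  unfold Pm M3 TF
  rcases h with h | h | h | h | h | h <;> obtain rfl | rfl | rfl | rfl | rfl : e = -2 ∨ e = -1 ∨ e = 0 ∨ e = 1 ∨ e = 2 := by omega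
  all_goals grind

theorem aba_P (p l c e : ℤ) (h : Pm Taba p l c) (h1 : -2 ≤ e) (h2 : e ≤ 2) :
    Pm TF l (p - l - c - e) c := by
  rcases h with h | h | h
  · have := m3_step l p c e (m3_perm _ _ _ h).1 h1 h2
    generalize p - l - c - e = z at *
    rcases this with h | ⟨rfl, ⟨rfl, rfl⟩ | ⟨rfl, rfl⟩⟩ | ⟨rfl, ⟨rfl, rfl⟩ | ⟨rfl, rfl⟩⟩
    · exact Or.inl h
    · right; left; unfold TF; norm_num
    · right; left; unfold TF; norm_num
    · right; right; unfold TF; norm_num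
    · right; right; unfold TF; norm_num
  · exact aba_P_aux p l c e h h1 h2
  · have := aba_P_aux (-p) (-l) (-c) (-e) h (by omega) (by omega)
    have := Pm_neg _ _ _ _ this
    simp only [neg_neg] at this
    convert this using 1
    ring

theorem aa_L_aux (p l c e : ℤ) (h : Taa p l c) (h1 : -2 ≤ e) (h2 : e ≤ 2) :
    Pm Taa p (l - p - c - e) c := by
  unfold Taa at h
  unfold Pm M3 Taa
  rcases h with h | h | h | h | h | h <;> obtain rfl | rfl | rfl | rfl | rfl : e = -2 ∨ e = -1 ∨ e = 0 ∨ e = 1 ∨ e = 2 := by omega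
  all_goals grind

theorem aa_L (p l c e : ℤ) (h : Pm Taa p l c) (h1 : -2 ≤ e) (h2 : e ≤ 2) :
    Pm Taa p (l - p - c - e) c := by
  rcases h with h | h | h
  · have := m3_step p l c e h h1 h2
    generalize l - p - c - e = z at *
    rcases this with h | ⟨rfl, ⟨rfl, rfl⟩ | ⟨rfl, rfl⟩⟩ | ⟨rfl, ⟨rfl, rfl⟩ | ⟨rfl, rfl⟩⟩
    · exact Or.inl h
    · right; left; unfold Taa; norm_num
    · right; left; unfold Taa; norm_num
    · right; right; unfold Taa; norm_num
    · right; right; unfold Taa; norm_num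
  · exact aa_L_aux p l c e h h1 h2
  · have := aa_L_aux (-p) (-l) (-c) (-e) h (by omega) (by omega)
    have := Pm_neg _ _ _ _ this
    simp only [neg_neg] at this
    convert this using 1
    ring

theorem aa_P_aux (p l c e : ℤ) (h : Taa p l c) (h1 : -2 ≤ e) (h2 : e ≤ 2) :
    Pm TF l (p - l - c - e) c := by
  unfold Taa at h
  unfold Pm M3 TF
  rcases h with h | h | h | h | h | h <;> obtain rfl | rfl | rfl | rfl | rfl : e = -2 ∨ e = -1 ∨ e = 0 ∨ e = 1 ∨ e = 2 := by omega
  all_goals grind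

theorem aa_P (p l c e : ℤ) (h : Pm Taa p l c) (h1 : -2 ≤ e) (h2 : e ≤ 2) :
    Pm TF l (p - l - c - e) c := by
  rcases h with h | h | h
  · have := m3_step l p c e (m3_perm _ _ _ h).1 h1 h2
    generalize p - l - c - e = z at *
    rcases this with h | ⟨rfl, ⟨rfl, rfl⟩ | ⟨rfl, rfl⟩⟩ | ⟨rfl, ⟨rfl, rfl⟩ | ⟨rfl, rfl⟩⟩
    · exact Or.inl h
    · right; left; unfold TF; norm_num
    · right; left; unfold TF; norm_num
    · right; right; unfold TF; norm_num
    · right; right; unfold TF; norm_num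
  · exact aa_P_aux p l c e h h1 h2
  · have := aa_P_aux (-p) (-l) (-c) (-e) h (by omega) (by omega)
    have := Pm_neg _ _ _ _ this
    simp only [neg_neg] at this
    convert this using 1
    ring

theorem F_C_aux (p l c e : ℤ) (h : TF p l c) (h1 : -2 ≤ e) (h2 : e ≤ 2) :
    Pm Tab l (c - l - p - e) p := by
  unfold TF at h
  unfold Pm M3 Tab
  rcases h with h | h | h | h | h | h | h <;> obtain rfl | rfl | rfl | rfl | rfl : e = -2 ∨ e = -1 ∨ e = 0 ∨ e = 1 ∨ e = 2 := by omega
  all_goals grind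

theorem F_C (p l c e : ℤ) (h : Pm TF p l c) (h1 : -2 ≤ e) (h2 : e ≤ 2) :
    Pm Tab l (c - l - p - e) p := by
  rcases h with h | h | h
  · have := m3_step l c p e (m3_perm _ _ _ h).2.1 h1 h2
    generalize c - l - p - e = z at *
    rcases this with h | ⟨rfl, ⟨rfl, rfl⟩ | ⟨rfl, rfl⟩⟩ | ⟨rfl, ⟨rfl, rfl⟩ | ⟨rfl, rfl⟩⟩
    · exact Or.inl h
    · right; left; unfold Tab; norm_num
    · right; left; unfold Tab; norm_num
    · right; right; unfold Tab; norm_num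
    · right; right; unfold Tab; norm_num
  · exact F_C_aux p l c e h h1 h2
  · have := F_C_aux (-p) (-l) (-c) (-e) h (by omega) (by omega)
    have := Pm_neg _ _ _ _ this
    simp only [neg_neg] at this
    convert this using 1
    ring

theorem aa_symm (p l c : ℤ) (h : Pm Taa p l c) : Pm Taa c l p := by
  unfold Pm at *
  rcases h with h | h | h
  · exact Or.inl (m3_perm _ _ _ h).2.2
  · right; left; unfold Taa at *; grind
  · right; right; unfold Taa at *; grind

theorem ab_aba (p l c : ℤ) (h : Pm Tab p l c) : Pm Taba p l c := by
  unfold Pm at *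
  rcases h with h | h | h
  · exact Or.inl h
  · right; left; unfold Tab at h; unfold Taba; grind
  · right; right; unfold Tab at h; unfold Taba; grind
theorem aba_F (p l c : ℤ) (h : Pm Taba p l c) : Pm TF p l c := by
  unfold Pm at *
  rcases h with h | h | h
  · exact Or.inl h
  · right; left; unfold Taba at h; unfold TF; grind
  · right; right; unfold Taba at h; unfold TF; grind
theorem init_ab (p l c : ℤ) (h : p + l + c = 0)
    (h3 : (3 ≤ p ∨ 3 ≤ l ∨ 3 ≤ c) ∨ (p ≤ -3 ∨ l ≤ -3 ∨ c ≤ -3)) : Pm Tab p l c := by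
  by_cases h5 : M3 p l c
  · exact Or.inl h5
  unfold M3 at h5
  right
  rcases h3 with h3 | h3
  · right; unfold Tab; rcases h3 with h3 | h3 | h3 <;> omega
  · left; unfold Tab; rcases h3 with h3 | h3 | h3 <;> omega

/-! ### Avoiding sequences and the run argument -/

/-- Prepend a letter to a sequence. -/
def scons (a : Fin 3) (s : ℕ → Fin 3) : ℕ → Fin 3
  | 0 => a
  | n + 1 => s n

/-- Drop the first letter of a sequence. -/
def stail (s : ℕ → Fin 3) : ℕ → Fin 3 := fun n => s (n + 1)

theorem scons_stail (s : ℕ → Fin 3) : scons (s 0) (stail s) = s := by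
  funext n
  cases n <;> rfl

/-- The sequence `s` avoids the forbidden patterns (elementary form). -/
def Av (s : ℕ → Fin 3) : Prop := ∀ n,
  (s (n + 1) = s n → s (n + 2) ≠ s n → s (n + 3) ≠ s n ∧ s (n + 3) ≠ s (n + 2)) ∧
  (s (n + 2) = s n → s (n + 3) = s (n + 1) → s (n + 1) ≠ s n →
    s (n + 4) ≠ s n ∧ s (n + 4) ≠ s (n + 1))

theorem Av.tail {a : Fin 3} {s : ℕ → Fin 3} (h : Av (scons a s)) : Av s :=
  fun n => h (n + 1)

/-- `x` is obtained as a sum of at most `n` steps with digits bounded by `b`. -/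
def ARep (b : ℤ) : ℕ → (ℕ → Fin 3) → (Fin 3 → ℤ) → Prop
  | 0, _, x => x = 0
  | n + 1, s, x => ∃ (y : Fin 3 → ℤ) (d : ℤ), -b ≤ d ∧ d ≤ b ∧
      (∀ j, x j = if j = s 0 then y 0 + y 1 + y 2 + d else y j) ∧ ARep b n (stail s) y

inductive ARKind
  | ab | aba | aa | F

/-- State invariant: compatible history and location of the vector. -/
def ARInv (k : ARKind) (p l c : Fin 3) (s : ℕ → Fin 3) (x : Fin 3 → ℤ) : Prop :=
  match k with
  | .ab => Av (scons p (scons l s)) ∧ Pm Tab (x p) (x l) (x c)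
  | .aba => Av (scons l (scons p (scons l s))) ∧ Pm Taba (x p) (x l) (x c)
  | .aa => Av (scons l (scons l s)) ∧ Pm Taa (x p) (x l) (x c)
  | .F => s 0 = c ∧ Av (scons p (scons l s)) ∧ Pm TF (x p) (x l) (x c)

theorem sum_perm {p l c : Fin 3} (h1 : p ≠ l) (h2 : p ≠ c) (h3 : l ≠ c) (y : Fin 3 → ℤ) :
    y 0 + y 1 + y 2 = y p + y l + y c := by
  fin_cases p <;> fin_cases l <;> fin_cases c <;> simp at h1 h2 h3 ⊢ <;> ring

theorem third {p l c : Fin 3} (h1 : p ≠ l) (h2 : p ≠ c) (h3 : l ≠ c) (a : Fin 3) :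
    a = p ∨ a = l ∨ a = c := by
  revert p l c a
  decide

theorem Pm_zero : ¬ Pm Tab 0 0 0 ∧ ¬ Pm Taba 0 0 0 ∧ ¬ Pm Taa 0 0 0 ∧ ¬ Pm TF 0 0 0 := by
  unfold Pm M3 Tab Taba Taa TF
  norm_num

theorem run (n : ℕ) : ∀ (k : ARKind) (p l c : Fin 3) (s : ℕ → Fin 3) (x : Fin 3 → ℤ),
    p ≠ l → p ≠ c → l ≠ c → ARInv k p l c s x → ARep 2 n s x → False := by
  induction n with
  | zero =>
    intro k p l c s x _ _ _ hI hR
    have hx : x = 0 := hR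
    subst hx
    obtain ⟨z1, z2, z3, z4⟩ := Pm_zero
    cases k
    · exact z1 hI.2
    · exact z2 hI.2
    · exact z3 hI.2
    · exact z4 hI.2.2
  | succ n ih =>
    intro k p l c s x hpl hpc hlc hI hR
    obtain ⟨y, d, hd1, hd2, hxy, hR'⟩ := hR
    obtain ⟨a, t, rfl⟩ : ∃ a t, s = scons a t := ⟨s 0, stail s, (scons_stail s).symm⟩
    change ARep 2 n t y at hR'
    change ∀ j, x j = if j = a then y 0 + y 1 + y 2 + d else y j at hxy
    rw [sum_perm hpl hpc hlc y] at hxy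
    have hxp := hxy p
    have hxl := hxy l
    have hxc := hxy c
    -- the three possible updates
    have caseP : a = p → y l = x l ∧ y c = x c ∧ y p = x p - x l - x c - d := by
      rintro rfl
      rw [if_pos rfl] at hxp
      rw [if_neg hpl.symm] at hxl
      rw [if_neg hpc.symm] at hxc
      refine ⟨hxl.symm, hxc.symm, by rw [hxp, hxl, hxc]; ring⟩
    have caseL : a = l → y p = x p ∧ y c = x c ∧ y l = x l - x p - x c - d := by
      rintro rfl
      rw [if_neg hpl] at hxp
      rw [if_pos rfl] at hxl
      rw [if_neg hlc.symm] at hxc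
      refine ⟨hxp.symm, hxc.symm, by rw [hxp, hxl, hxc]; ring⟩
    have caseC : a = c → y p = x p ∧ y l = x l ∧ y c = x c - x l - x p - d := by
      rintro rfl
      rw [if_neg hpc] at hxp
      rw [if_neg hlc] at hxl
      rw [if_pos rfl] at hxc
      refine ⟨hxp.symm, hxl.symm, by rw [hxp, hxl, hxc]; ring⟩
    cases k with
    | ab =>
      obtain ⟨hA, hP⟩ := hI
      rcases third hpl hpc hlc a with ha | ha | ha
      · obtain ⟨e1, e2, e3⟩ := caseP ha
        subst ha
        refine ih .aba l a c t y hpl.symm hlc hpc ⟨hA, ?_⟩ hR'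
        rw [e1, e2, e3]
        exact ab_P _ _ _ _ hP hd1 hd2
      · obtain ⟨e1, e2, e3⟩ := caseL ha
        subst ha
        refine ih .aa p a c t y hpl hpc hlc ⟨hA.tail, ?_⟩ hR'
        rw [e1, e2, e3]
        exact aba_L _ _ _ _ (ab_aba _ _ _ hP) hd1 hd2
      · obtain ⟨e1, e2, e3⟩ := caseC ha
        subst ha
        refine ih .ab l a p t y hlc hpl.symm hpc.symm ⟨hA.tail, ?_⟩ hR'
        rw [e1, e2, e3]
        exact F_C _ _ _ _ (aba_F _ _ _ (ab_aba _ _ _ hP)) hd1 hd2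
    | aba =>
      obtain ⟨hA, hP⟩ := hI
      rcases third hpl hpc hlc a with ha | ha | ha
      · obtain ⟨e1, e2, e3⟩ := caseP ha
        subst ha
        have h0 := (hA 0).2 rfl rfl hpl
        change t 0 ≠ l ∧ t 0 ≠ a at h0
        have ht : t 0 = c := by
          rcases third hpl hpc hlc (t 0) with h | h | h
          · exact absurd h h0.2
          · exact absurd h h0.1
          · exact h
        refine ih .F l a c t y hpl.symm hlc hpc ⟨ht, hA.tail.tail, ?_⟩ hR'
        rw [e1, e2, e3]
        exact aba_P _ _ _ _ hP hd1 hd2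
      · obtain ⟨e1, e2, e3⟩ := caseL ha
        subst ha
        refine ih .aa p a c t y hpl hpc hlc ⟨hA.tail.tail, ?_⟩ hR'
        rw [e1, e2, e3]
        exact aba_L _ _ _ _ hP hd1 hd2
      · obtain ⟨e1, e2, e3⟩ := caseC ha
        subst ha
        refine ih .ab l a p t y hlc hpl.symm hpc.symm ⟨hA.tail.tail, ?_⟩ hR'
        rw [e1, e2, e3]
        exact F_C _ _ _ _ (aba_F _ _ _ hP) hd1 hd2
    | aa =>
      obtain ⟨hA, hP⟩ := hI
      rcases third hpl hpc hlc a with ha | ha | ha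
      · obtain ⟨e1, e2, e3⟩ := caseP ha
        subst ha
        have h0 := (hA 0).1 rfl hpl
        change t 0 ≠ l ∧ t 0 ≠ a at h0
        have ht : t 0 = c := by
          rcases third hpl hpc hlc (t 0) with h | h | h
          · exact absurd h h0.2
          · exact absurd h h0.1
          · exact h
        refine ih .F l a c t y hpl.symm hlc hpc ⟨ht, hA.tail, ?_⟩ hR'
        rw [e1, e2, e3]
        exact aa_P _ _ _ _ hP hd1 hd2
      · obtain ⟨e1, e2, e3⟩ := caseL ha
        subst ha
        refine ih .aa p a c t y hpl hpc hlc ⟨hA.tail, ?_⟩ hR'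
        rw [e1, e2, e3]
        exact aa_L _ _ _ _ hP hd1 hd2
      · obtain ⟨e1, e2, e3⟩ := caseC ha
        subst ha
        have h0 := (hA 0).1 rfl hlc.symm
        change t 0 ≠ l ∧ t 0 ≠ a at h0
        have ht : t 0 = p := by
          rcases third hpl hpc hlc (t 0) with h | h | h
          · exact h
          · exact absurd h h0.1
          · exact absurd h h0.2
        refine ih .F l a p t y hlc hpl.symm hpc.symm ⟨ht, hA.tail, ?_⟩ hR'
        rw [e1, e2, e3]
        exact aa_P _ _ _ _ (aa_symm _ _ _ hP) hd1 hd2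
    | F =>
      obtain ⟨ht, hA, hP⟩ := hI
      obtain ⟨e1, e2, e3⟩ := caseC ht
      change a = c at ht
      subst ht
      refine ih .ab l a p t y hlc hpl.symm hpc.symm ⟨hA.tail, ?_⟩ hR'
      rw [e1, e2, e3]
      exact F_C _ _ _ _ hP hd1 hd2

/-- A suitable two-letter fake history. -/
theorem exists_history (s : ℕ → Fin 3) (h : Av s) : ∃ p l c : Fin 3,
    p ≠ l ∧ p ≠ c ∧ l ≠ c ∧ Av (scons p (scons l s)) := by
  have key : ∀ a b : Fin 3, ∃ p l : Fin 3, p ≠ l ∧ p ≠ a ∧ l ≠ a ∧ l ≠ b := by decide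
  obtain ⟨p, l, h1, h2, h3, h4⟩ := key (s 0) (s 1)
  refine ⟨p, l, s 0, h1, h2, h3, ?_⟩
  intro n
  match n with
  | 0 => exact ⟨fun e => absurd e.symm h1, fun e => absurd e.symm h2⟩
  | 1 => exact ⟨fun e => absurd e.symm h3, fun e => absurd e.symm h4⟩
  | n + 2 => exact h n

theorem Av_of_avoid (dir : ℕ → Fin 3)
    (havoid : ∀ w ∈ ForbiddenPatterns, ¬ FactorOf dir w) : Av dir := by
  have perm : ∀ a b : Fin 3, b ≠ a → ∃ π : Equiv.Perm (Fin 3), π 0 = a ∧ π 1 = b := by decide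
  have f4 : ∀ n, FactorOf dir [dir n, dir (n + 1), dir (n + 2), dir (n + 3)] :=
    fun n => ⟨n, rfl⟩
  have f5 : ∀ n, FactorOf dir [dir n, dir (n + 1), dir (n + 2), dir (n + 3), dir (n + 4)] :=
    fun n => ⟨n, rfl⟩
  intro n
  constructor
  · intro e1 e2
    obtain ⟨π, p0, p1⟩ := perm _ _ e2
    constructor <;> intro e3 <;> refine havoid _ ⟨π, ?_⟩ (f4 n) <;> simp [e1, e3, p0, p1]
  · intro e1 e2 e3
    obtain ⟨π, p0, p1⟩ := perm _ _ e3
    constructor <;> intro e4 <;> refine havoid _ ⟨π, ?_⟩ (f5 n) <;> simp [e1, e2, e4, p0, p1]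

/-! ### Desubstitution of words -/

/-- Abelianization. -/
def cnt (u : List (Fin 3)) : Fin 3 → ℤ := fun j => (u.count j : ℤ)

/-- `x` is the image of `y` under the matrix of `σ_i`, plus `d` times `e_i`. -/
def ARLift (i : Fin 3) (x y : Fin 3 → ℤ) (d : ℤ) : Prop :=
  ∀ j, x j = if j = i then y 0 + y 1 + y 2 + d else y j

theorem ARLift.cons_self {i : Fin 3} {u v : List (Fin 3)} {d : ℤ} (h : ARLift i (cnt u) (cnt v) d) :
    ARLift i (cnt (i :: u)) (cnt (i :: v)) d := by
  intro j
  have := h j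
  simp only [cnt, List.count_cons] at *
  fin_cases i <;> fin_cases j <;> simp at * <;> omega

theorem ARLift.cons_ne {i a : Fin 3} (ha : a ≠ i) {u v : List (Fin 3)} {d : ℤ}
    (h : ARLift i (cnt u) (cnt v) d) :
    ARLift i (cnt (a :: i :: u)) (cnt (a :: v)) d := by
  intro j
  have := h j
  simp only [cnt, List.count_cons] at *
  fin_cases i <;> fin_cases j <;> fin_cases a <;> simp at * <;> omega

theorem ARLift.cons_extra {i : Fin 3} {u v : List (Fin 3)} {d : ℤ} (h : ARLift i (cnt u) (cnt v) d) :
    ARLift i (cnt (i :: u)) (cnt v) (d + 1) := by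
  intro j
  have := h j
  simp only [cnt, List.count_cons] at *
  fin_cases i <;> fin_cases j <;> simp at * <;> omega

theorem ARLift.nil (i : Fin 3) : ARLift i (cnt []) (cnt []) 0 := by
  intro j
  simp [cnt]

theorem ARLift.single {i a : Fin 3} (ha : a ≠ i) : ARLift i (cnt [a]) (cnt [a]) (-1) := by
  intro j
  simp only [cnt, List.count_cons]
  fin_cases i <;> fin_cases j <;> fin_cases a <;> simp at *

theorem sigma_cons_self (i : Fin 3) (w : List (Fin 3)) :
    sigmaSub i (i :: w) = i :: sigmaSub i w := by
  simp [sigmaSub]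

theorem sigma_cons_ne {i a : Fin 3} (ha : a ≠ i) (w : List (Fin 3)) :
    sigmaSub i (a :: w) = a :: i :: sigmaSub i w := by
  simp [sigmaSub, ha]

theorem desub_prefix (i : Fin 3) : ∀ (w u : List (Fin 3)), u <+: sigmaSub i w →
    ∃ v d, v <+: w ∧ -1 ≤ d ∧ d ≤ 0 ∧ ARLift i (cnt u) (cnt v) d := by
  intro w
  induction w with
  | nil =>
    intro u hu
    have : u = [] := by simpa [sigmaSub] using hu
    subst this
    exact ⟨[], 0, List.nil_prefix, by norm_num, by norm_num, ARLift.nil i⟩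
  | cons a w ih =>
    intro u hu
    by_cases ha : a = i
    · subst ha
      rw [sigma_cons_self, List.prefix_cons_iff] at hu
      rcases hu with rfl | ⟨t, rfl, ht⟩
      · exact ⟨[], 0, List.nil_prefix, by norm_num, by norm_num, ARLift.nil _⟩
      · obtain ⟨v, d, hv, h1, h2, h3⟩ := ih t ht
        exact ⟨a :: v, d, by simpa using hv, h1, h2, h3.cons_self⟩
    · rw [sigma_cons_ne ha, List.prefix_cons_iff] at hu
      rcases hu with rfl | ⟨t, rfl, ht⟩
      · exact ⟨[], 0, List.nil_prefix, by norm_num, by norm_num, ARLift.nil _⟩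
      · rw [List.prefix_cons_iff] at ht
        rcases ht with rfl | ⟨t, rfl, ht⟩
        · exact ⟨[a], -1, by simp, by norm_num, by norm_num, ARLift.single ha⟩
        · obtain ⟨v, d, hv, h1, h2, h3⟩ := ih t ht
          exact ⟨a :: v, d, by simpa using hv, h1, h2, h3.cons_ne ha⟩

theorem desub (i : Fin 3) : ∀ (w u : List (Fin 3)), u <:+: sigmaSub i w →
    ∃ v d, v <:+: w ∧ -1 ≤ d ∧ d ≤ 1 ∧ ARLift i (cnt u) (cnt v) d := by
  intro w
  induction w with
  | nil =>
    intro u hu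
    have : u = [] := by simpa [sigmaSub] using hu
    subst this
    exact ⟨[], 0, List.nil_infix, by norm_num, by norm_num, ARLift.nil i⟩
  | cons a w ih =>
    intro u hu
    have viaPrefix : u <+: sigmaSub i (a :: w) →
        ∃ v d, v <:+: a :: w ∧ -1 ≤ d ∧ d ≤ 1 ∧ ARLift i (cnt u) (cnt v) d := by
      intro hp
      obtain ⟨v, d, hv, h1, h2, h3⟩ := desub_prefix i _ u hp
      exact ⟨v, d, hv.isInfix, h1, by omega, h3⟩
    have viaTail : u <:+: sigmaSub i w →
        ∃ v d, v <:+: a :: w ∧ -1 ≤ d ∧ d ≤ 1 ∧ ARLift i (cnt u) (cnt v) d := by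
      intro hp
      obtain ⟨v, d, hv, h1, h2, h3⟩ := ih u hp
      exact ⟨v, d, hv.trans (List.suffix_cons a w).isInfix, h1, h2, h3⟩
    by_cases ha : a = i
    · subst ha
      have hu' := hu
      rw [sigma_cons_self, List.infix_cons_iff] at hu'
      rcases hu' with h | h
      · exact viaPrefix (by rw [sigma_cons_self]; exact h)
      · exact viaTail h
    · have hu' := hu
      rw [sigma_cons_ne ha, List.infix_cons_iff, List.infix_cons_iff] at hu'
      rcases hu' with h | h | h
      · exact viaPrefix (by rw [sigma_cons_ne ha]; exact h)
      · rw [List.prefix_cons_iff] at h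
        rcases h with rfl | ⟨t, rfl, ht⟩
        · exact ⟨[], 0, List.nil_infix, by norm_num, by norm_num, ARLift.nil _⟩
        · obtain ⟨v, d, hv, h1, h2, h3⟩ := desub_prefix i _ t ht
          exact ⟨v, d + 1, hv.isInfix.trans (List.suffix_cons a w).isInfix, by omega, by omega,
            h3.cons_extra⟩
      · exact viaTail h

theorem ARword_succ (s : ℕ → Fin 3) (n : ℕ) :
    ARword s (n + 1) = sigmaSub (s 0) (ARword (stail s) n) := by
  unfold ARword
  rw [List.range_succ_eq_map]
  rw [List.map_cons, List.map_map, List.foldr_cons]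
  rfl

theorem cnt_nil : cnt [] = 0 := by
  funext j
  simp [cnt]

theorem ARep_single (k : ℕ) : ∀ s : ℕ → Fin 3, s k = 0 → ∃ N, ARep 1 N s (cnt [0]) := by
  induction k with
  | zero =>
    intro s hs
    refine ⟨1, cnt [], 1, by norm_num, by norm_num, ?_, cnt_nil⟩
    rw [hs]
    have := (ARLift.nil (0 : Fin 3)).cons_extra
    simpa [ARLift] using this
  | succ k ih =>
    intro s hs
    by_cases h0 : s 0 = 0
    · refine ⟨1, cnt [], 1, by norm_num, by norm_num, ?_, cnt_nil⟩
      rw [h0]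
      have := (ARLift.nil (0 : Fin 3)).cons_extra
      simpa [ARLift] using this
    · obtain ⟨N, hN⟩ := ih (stail s) hs
      exact ⟨N + 1, cnt [0], -1, by norm_num, by norm_num, ARLift.single (Ne.symm h0), hN⟩

theorem ARep_word (n : ℕ) : ∀ (s : ℕ → Fin 3), (∀ m, ∃ k, m ≤ k ∧ s k = 0) →
    ∀ u, u <:+: ARword s n → ∃ N, ARep 1 N s (cnt u) := by
  induction n with
  | zero =>
    intro s hs u hu
    have hu' : u <:+: [0] := by simpa [ARword] using hu
    rw [List.infix_cons_iff, List.prefix_cons_iff] at hu'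
    obtain ⟨k, -, hk⟩ := hs 0
    rcases hu' with (rfl | ⟨t, rfl, ht⟩) | h
    · exact ⟨0, cnt_nil⟩
    · have : t = [] := by simpa using ht
      subst this
      exact ARep_single k s hk
    · have : u = [] := by simpa using h
      subst this
      exact ⟨0, cnt_nil⟩
  | succ n ih =>
    intro s hs u hu
    rw [ARword_succ] at hu
    obtain ⟨v, d, hv, h1, h2, h3⟩ := desub _ _ _ hu
    have hs' : ∀ m, ∃ k, m ≤ k ∧ stail s k = 0 := by
      intro m
      obtain ⟨k, hk, hk0⟩ := hs (m + 1)
      obtain ⟨k, rfl⟩ : ∃ k', k = k' + 1 := ⟨k - 1, by omega⟩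
      exact ⟨k, by omega, hk0⟩
    obtain ⟨N, hN⟩ := ih (stail s) hs' v hv
    exact ⟨N + 1, cnt v, d, h1, h2, h3, hN⟩

theorem ARep_sub (n : ℕ) : ∀ (m : ℕ) (s : ℕ → Fin 3) (x y : Fin 3 → ℤ),
    ARep 1 n s x → ARep 1 m s y → ∃ N, ARep 2 N s (x - y) := by
  induction n with
  | zero =>
    intro m
    induction m with
    | zero =>
      intro s x y hx hy
      have hx : x = 0 := hx
      have hy : y = 0 := hy
      exact ⟨0, by subst hx hy; simp [ARep]⟩
    | succ m ih =>
      intro s x y hx hy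
      have hx : x = 0 := hx
      subst hx
      obtain ⟨y', d, h1, h2, h3, h4⟩ := hy
      obtain ⟨N, hN⟩ := ih (stail s) 0 y' rfl h4
      refine ⟨N + 1, 0 - y', -d, by omega, by omega, ?_, hN⟩
      intro j
      simp only [Pi.sub_apply, Pi.zero_apply, h3 j]
      split_ifs <;> ring
  | succ n ih =>
    intro m s x y hx hy
    obtain ⟨x', d, h1, h2, h3, h4⟩ := hx
    cases m with
    | zero =>
      have hy : y = 0 := hy
      subst hy
      obtain ⟨N, hN⟩ := ih 0 (stail s) x' 0 h4 rfl
      refine ⟨N + 1, x' - 0, d, by omega, by omega, ?_, hN⟩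
      intro j
      simp only [Pi.sub_apply, Pi.zero_apply, h3 j]
      split_ifs <;> ring
    | succ m =>
      obtain ⟨y', d', g1, g2, g3, g4⟩ := hy
      obtain ⟨N, hN⟩ := ih m (stail s) x' y' h4 g4
      refine ⟨N + 1, x' - y', d - d', by omega, by omega, ?_, hN⟩
      intro j
      simp only [Pi.sub_apply, h3 j, g3 j]
      split_ifs <;> ring

theorem length_eq_cnt (u : List (Fin 3)) : (u.length : ℤ) = cnt u 0 + cnt u 1 + cnt u 2 := by
  induction u with
  | nil => simp [cnt]
  | cons a u ih =>
    simp only [cnt, List.count_cons, List.length_cons] at *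
    fin_cases a <;> simp <;> omega

/-- Remark: if the directive sequence of an Arnoux-Rauzy word `ω` contains no
factor in the set `X` generated by `1121, 1122, 12121, 12122` under letter
permutations, then `ω` is `2`-balanced. -/
theorem two_balanced_of_avoiding_patterns
    (ω dir : ℕ → Fin 3) (hAR : IsAR ω dir)
    (havoid : ∀ w ∈ ForbiddenPatterns, ¬ FactorOf dir w) :
    IsBalanced 2 ω := by
  intro u v hu hv hlen j
  obtain ⟨hinf, hfac⟩ := hAR
  obtain ⟨n, hn⟩ := (hfac u).1 hu
  obtain ⟨m, hm⟩ := (hfac v).1 hv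
  obtain ⟨N, hN⟩ := ARep_word n dir (hinf 0) u hn
  obtain ⟨M, hM⟩ := ARep_word m dir (hinf 0) v hm
  obtain ⟨K, hK⟩ := ARep_sub N M dir _ _ hN hM
  obtain ⟨p, l, c, hpl, hpc, hlc, hA⟩ := exists_history dir (Av_of_avoid dir havoid)
  by_contra hcon
  have hj : 3 ≤ (cnt u - cnt v) j ∨ (cnt u - cnt v) j ≤ -3 := by
    simp only [Pi.sub_apply, cnt]
    rw [abs_le] at hcon
    push_cast at hcon
    omega
  have hsum : (cnt u - cnt v) 0 + (cnt u - cnt v) 1 + (cnt u - cnt v) 2 = 0 := by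
    have h1 := length_eq_cnt u
    have h2 := length_eq_cnt v
    simp only [Pi.sub_apply]
    rw [hlen] at h1
    omega
  rw [sum_perm hpl hpc hlc] at hsum
  refine run K .ab p l c dir _ hpl hpc hlc ⟨hA, init_ab _ _ _ hsum ?_⟩ hK
  rcases third hpl hpc hlc j with rfl | rfl | rfl <;> rcases hj with h | h <;> simp only [h, true_or, or_true]
end

section
/- There exist 2-balanced Arnoux-Rauzy words over {1,2,3} with unbounded weak partial quotients. More precisely, for any sequence (s_n) of positive integers, the Arnoux-Rauzy word with directive sequence 1^{s_0} 2 3 1^{s_1} 2 3 1^{s_2} 2 3 ⋯ is 2-balanced. -/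
/-- Desubstitution of a prefix of `σ_i(W)`. -/
lemma desub_prefix_s11 {A : Type*} [DecidableEq A] (i : A) (W : List A) :
    ∀ u : List A, u <+: sigmaSub i W → ∃ V, V <+: W ∧
      (∀ j, j ≠ i → u.count j = V.count j) ∧
      (u.count i = V.length ∨ u.count i + 1 = V.length) := by
  induction W with
  | nil =>
    intro u h
    have hu : u = [] := by simpa [sigmaSub] using h
    subst hu
    exact ⟨[], by simp, by simp, by simp⟩
  | cons a W ih =>
    intro u h
    by_cases ha : a = i
    · subst ha
      have h' : u <+: a :: sigmaSub a W := by simpa [sigmaSub] using h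
      cases u with
      | nil => exact ⟨[], by simp, by simp, by simp⟩
      | cons b u =>
        rw [List.cons_prefix_cons] at h'
        obtain ⟨rfl, h1⟩ := h'
        obtain ⟨V, hV, hc, hl⟩ := ih u h1
        refine ⟨b :: V, by simpa using hV, ?_, ?_⟩
        · intro j hj
          simp [List.count_cons, hc j hj]
        · simp only [List.count_cons_self, List.length_cons]
          omega
    · have h' : u <+: a :: i :: sigmaSub i W := by simpa [sigmaSub, ha] using h
      cases u with
      | nil => exact ⟨[], by simp, by simp, by simp⟩
      | cons b u =>
        rw [List.cons_prefix_cons] at h'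
        obtain ⟨rfl, h1⟩ := h'
        cases u with
        | nil => exact ⟨[b], by simp, by simp, by simp [ha]⟩
        | cons c u =>
          rw [List.cons_prefix_cons] at h1
          obtain ⟨rfl, h2⟩ := h1
          obtain ⟨V, hV, hc, hl⟩ := ih u h2
          refine ⟨b :: V, by simpa using hV, ?_, ?_⟩
          · intro j hj
            simp [List.count_cons, hc j hj, Ne.symm hj]
          · have hb : (b :: c :: u).count c = u.count c + 1 := by simp [ha]
            rw [hb, List.length_cons]
            omega

/-- Desubstitution of a factor of `σ_i(W)`. -/
lemma desub_infix {A : Type*} [DecidableEq A] (i : A) (W : List A) :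
    ∀ u : List A, u <:+: sigmaSub i W → ∃ V, V <:+: W ∧
      (∀ j, j ≠ i → u.count j = V.count j) ∧
      (u.count i ≤ V.length + 1 ∧ V.length ≤ u.count i + 1) := by
  induction W with
  | nil =>
    intro u h
    have hu : u = [] := by simpa [sigmaSub] using h
    subst hu
    exact ⟨[], by simp, by simp, by simp⟩
  | cons a W ih =>
    intro u h
    have key : u <+: sigmaSub i (a :: W) → ∃ V, V <:+: a :: W ∧
      (∀ j, j ≠ i → u.count j = V.count j) ∧
      (u.count i ≤ V.length + 1 ∧ V.length ≤ u.count i + 1) := by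
      intro hp
      obtain ⟨V, hV, hc, hl⟩ := desub_prefix_s11 i (a :: W) u hp
      exact ⟨V, hV.isInfix, hc, by omega⟩
    have key2 : u <:+: sigmaSub i W → ∃ V, V <:+: a :: W ∧
      (∀ j, j ≠ i → u.count j = V.count j) ∧
      (u.count i ≤ V.length + 1 ∧ V.length ≤ u.count i + 1) := by
      intro hp
      obtain ⟨V, hV, hc, hl⟩ := ih u hp
      exact ⟨V, List.infix_cons_iff.2 (Or.inr hV), hc, hl⟩
    by_cases ha : a = i
    · have he : sigmaSub i (a :: W) = i :: sigmaSub i W := by simp [sigmaSub, ha]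
      rw [he] at h key
      rcases List.infix_cons_iff.1 h with h | h
      · exact key h
      · exact key2 h
    · have he : sigmaSub i (a :: W) = a :: i :: sigmaSub i W := by simp [sigmaSub, ha]
      rw [he] at h key
      rcases List.infix_cons_iff.1 h with h | h
      · exact key h
      rcases List.infix_cons_iff.1 h with h | h
      · cases u with
        | nil => exact ⟨[], by simp, by simp, by simp⟩
        | cons c u =>
          rw [List.cons_prefix_cons] at h
          obtain ⟨rfl, h1⟩ := h
          obtain ⟨V, hV, hc, hl⟩ := desub_prefix_s11 c W u h1
          refine ⟨V, List.infix_cons_iff.2 (Or.inr hV.isInfix), ?_, ?_⟩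
          · intro j hj
            simp [List.count_cons, hc j hj, Ne.symm hj]
          · simp only [List.count_cons_self]
            omega
      · exact key2 h

lemma length_eq_counts (u : List (Fin 3)) :
    u.length = u.count 0 + u.count 1 + u.count 2 := by
  induction u with
  | nil => simp
  | cons a u ih =>
    fin_cases a <;> simp [List.count_cons, ih] <;> omega

/-- Forbidden difference vectors inside a run of the letter `1`. -/
def ForbA (x b c : ℤ) : Prop :=
  ¬ (-2 ≤ b ∧ b ≤ 2 ∧ -2 ≤ c ∧ c ≤ 2 ∧ -2 ≤ b + c ∧ b + c ≤ 2) ∧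
  (2 ≤ b + c → (x ≤ -(b + c) ∨ x ≤ -(b + c) - b - 1) ∧
    (0 < b → 0 < c → x ≤ -(b + c) - 1)) ∧
  (b + c ≤ -2 → (-(b + c) ≤ x ∨ -(b + c) - b + 1 ≤ x) ∧
    (b < 0 → c < 0 → -(b + c) + 1 ≤ x))

/-- Forbidden difference vectors at the start of a block `1^s 2 3`. -/
def ForbC (x b c : ℤ) : Prop :=
  ∀ e : ℤ, -2 ≤ e → e ≤ 2 → ForbA (x - b - c - e) b c

/-- Forbidden difference vectors between the letters `2` and `3` of a block. -/
def ForbB (x b c : ℤ) : Prop :=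
  ∀ e : ℤ, -2 ≤ e → e ≤ 2 → ForbC x b (c - x - b - e)

lemma forbA_step {x b c e : ℤ} (h : ForbA x b c) (h1 : -2 ≤ e) (h2 : e ≤ 2) :
    ForbA (x - b - c - e) b c := by
  unfold ForbA at *
  obtain ⟨h3, h4, h5⟩ := h
  refine ⟨h3, fun hm => ?_, fun hm => ?_⟩
  · have := h4 hm
    omega
  · have := h5 hm
    omega

set_option maxHeartbeats 4000000 in
lemma forbA_cycle {x b c e : ℤ} (h : ForbA x b c) (h1 : -2 ≤ e) (h2 : e ≤ 2) :
    ForbB x (b - x - c - e) c := by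
  intro f hf1 hf2 g hg1 hg2
  obtain ⟨h3, h4, h5⟩ := h
  refine ⟨?_, fun hm => ⟨?_, ?_⟩, fun hm => ⟨?_, ?_⟩⟩ <;> omega

lemma forbC_start {x b c : ℤ} (h : x + b + c = 0)
    (hb : ¬ (-2 ≤ b ∧ b ≤ 2 ∧ -2 ≤ c ∧ c ≤ 2 ∧ -2 ≤ x ∧ x ≤ 2)) : ForbC x b c := by
  intro e h1 h2
  refine ⟨?_, fun hm => ⟨?_, ?_⟩, fun hm => ⟨?_, ?_⟩⟩ <;> omega

/-- The word `W` has two factors whose difference vector satisfies `G`. -/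
def HasPair (G : ℤ → ℤ → ℤ → Prop) (W : List (Fin 3)) : Prop :=
  ∃ u v : List (Fin 3), u <:+: W ∧ v <:+: W ∧
    G ((u.count 0 : ℤ) - v.count 0) ((u.count 1 : ℤ) - v.count 1) ((u.count 2 : ℤ) - v.count 2)

lemma hasPair_step0 {G G' : ℤ → ℤ → ℤ → Prop} {W : List (Fin 3)}
    (hG : ∀ x b c e, G x b c → -2 ≤ e → e ≤ 2 → G' (x - b - c - e) b c)
    (h : HasPair G (sigmaSub 0 W)) : HasPair G' W := by
  obtain ⟨u, v, hu, hv, hd⟩ := h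
  obtain ⟨u', hu', hcu, hlu⟩ := desub_infix 0 W u hu
  obtain ⟨v', hv', hcv, hlv⟩ := desub_infix 0 W v hv
  refine ⟨u', v', hu', hv', ?_⟩
  rw [length_eq_counts] at hlu hlv
  rw [hcu 1 (by decide), hcu 2 (by decide), hcv 1 (by decide), hcv 2 (by decide)] at hd
  have := hG _ _ _ (((u.count 0 : ℤ) - v.count 0) - ((u'.count 1 : ℤ) - v'.count 1)
    - ((u'.count 2 : ℤ) - v'.count 2) - ((u'.count 0 : ℤ) - v'.count 0)) hd (by omega) (by omega)
  convert this using 1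
  ring

lemma hasPair_step1 {G G' : ℤ → ℤ → ℤ → Prop} {W : List (Fin 3)}
    (hG : ∀ x b c e, G x b c → -2 ≤ e → e ≤ 2 → G' x (b - x - c - e) c)
    (h : HasPair G (sigmaSub 1 W)) : HasPair G' W := by
  obtain ⟨u, v, hu, hv, hd⟩ := h
  obtain ⟨u', hu', hcu, hlu⟩ := desub_infix 1 W u hu
  obtain ⟨v', hv', hcv, hlv⟩ := desub_infix 1 W v hv
  refine ⟨u', v', hu', hv', ?_⟩
  rw [length_eq_counts] at hlu hlv
  rw [hcu 0 (by decide), hcu 2 (by decide), hcv 0 (by decide), hcv 2 (by decide)] at hd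
  have := hG _ _ _ (((u.count 1 : ℤ) - v.count 1) - ((u'.count 0 : ℤ) - v'.count 0)
    - ((u'.count 2 : ℤ) - v'.count 2) - ((u'.count 1 : ℤ) - v'.count 1)) hd (by omega) (by omega)
  convert this using 1
  ring

lemma hasPair_step2 {G G' : ℤ → ℤ → ℤ → Prop} {W : List (Fin 3)}
    (hG : ∀ x b c e, G x b c → -2 ≤ e → e ≤ 2 → G' x b (c - x - b - e))
    (h : HasPair G (sigmaSub 2 W)) : HasPair G' W := by
  obtain ⟨u, v, hu, hv, hd⟩ := h
  obtain ⟨u', hu', hcu, hlu⟩ := desub_infix 2 W u hu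
  obtain ⟨v', hv', hcv, hlv⟩ := desub_infix 2 W v hv
  refine ⟨u', v', hu', hv', ?_⟩
  rw [length_eq_counts] at hlu hlv
  rw [hcu 0 (by decide), hcu 1 (by decide), hcv 0 (by decide), hcv 1 (by decide)] at hd
  have := hG _ _ _ (((u.count 2 : ℤ) - v.count 2) - ((u'.count 0 : ℤ) - v'.count 0)
    - ((u'.count 1 : ℤ) - v'.count 1) - ((u'.count 2 : ℤ) - v'.count 2)) hd (by omega) (by omega)
  convert this using 1
  ring

/-- The word `σ_{i_k} ⋯ σ_{i_{k+m-1}}(1)`. -/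
def levelWord (dir : ℕ → Fin 3) (k m : ℕ) : List (Fin 3) :=
  ((List.range' k m).map dir).foldr sigmaSub [0]

lemma levelWord_succ (dir : ℕ → Fin 3) (k m : ℕ) :
    levelWord dir k (m + 1) = sigmaSub (dir k) (levelWord dir (k + 1) m) := by
  simp [levelWord, List.range'_succ]

lemma ARword_eq (dir : ℕ → Fin 3) (n : ℕ) : ARword dir n = levelWord dir 0 n := by
  simp [levelWord, ARword, List.range_eq_range']

lemma sigmaSub_prefix (i : Fin 3) {U V : List (Fin 3)} (h : U <+: V) :
    sigmaSub i U <+: sigmaSub i V := by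
  obtain ⟨t, rfl⟩ := h
  exact ⟨sigmaSub i t, by simp [sigmaSub]⟩

lemma levelWord_prefix (dir : ℕ → Fin 3) (m : ℕ) :
    ∀ k, levelWord dir k m <+: levelWord dir k (m + 1) := by
  induction m with
  | zero =>
    intro k
    rw [levelWord_succ]
    simp only [levelWord, List.range'_zero, List.map_nil, List.foldr_nil, sigmaSub,
      List.flatMap_cons, List.flatMap_nil]
    split_ifs with h
    · simp [← h]
    · simp
  | succ m ih =>
    intro k
    rw [levelWord_succ, levelWord_succ dir k (m + 1)]
    exact sigmaSub_prefix _ (ih (k + 1))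

lemma ARword_mono (dir : ℕ → Fin 3) {m n : ℕ} (h : m ≤ n) : ARword dir m <+: ARword dir n := by
  induction n, h using Nat.le_induction with
  | base => exact List.prefix_refl _
  | succ n _ ih =>
    refine ih.trans ?_
    rw [ARword_eq, ARword_eq]
    exact levelWord_prefix dir n 0

/-- A run of the letter `1`. -/
lemma hasPair_run (dir : ℕ → Fin 3) (m : ℕ) : ∀ (r k : ℕ), (∀ t, t < r → dir (k + t) = 0) →
    HasPair ForbA (levelWord dir k (r + m)) → HasPair ForbA (levelWord dir (k + r) m) := by
  intro r
  induction r with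
  | zero => intro k _ h; simpa using h
  | succ r ih =>
    intro k hk h
    rw [show r + 1 + m = (r + m) + 1 by ring, levelWord_succ] at h
    have h0 : dir k = 0 := by simpa using hk 0 (by omega)
    rw [h0] at h
    have h1 := hasPair_step0 (fun x b c e hA => forbA_step hA) h
    have h2 := ih (k + 1) (fun t ht => by
      have := hk (t + 1) (by omega)
      rwa [show k + 1 + t = k + (t + 1) by ring]) h1
    rwa [show k + (r + 1) = k + 1 + r by ring]

/-- One full block `1^s 2 3`. -/
lemma hasPair_block (dir : ℕ → Fin 3) (m k r : ℕ) (h0 : ∀ t, t < r + 1 → dir (k + t) = 0)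
    (h1 : dir (k + (r + 1)) = 1) (h2 : dir (k + (r + 2)) = 2)
    (h : HasPair ForbC (levelWord dir k (r + 1 + 2 + m))) :
    HasPair ForbC (levelWord dir (k + (r + 1) + 2) m) := by
  rw [show r + 1 + 2 + m = (r + (m + 2)) + 1 by ring, levelWord_succ] at h
  have hk : dir k = 0 := by simpa using h0 0 (by omega)
  rw [hk] at h
  have hA := hasPair_step0 (G' := ForbA) (fun x b c e hC h1 h2 => hC e h1 h2) h
  have hA2 := hasPair_run dir (m + 2) r (k + 1) (fun t ht => by
      have := h0 (t + 1) (by omega)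
      rwa [show k + 1 + t = k + (t + 1) by ring]) hA
  rw [levelWord_succ, show k + 1 + r = k + (r + 1) by ring, h1] at hA2
  have hB := hasPair_step1 (G' := ForbB) (fun x b c e hC => forbA_cycle hC) hA2
  rw [levelWord_succ, show k + (r + 1) + 1 = k + (r + 2) by ring, h2] at hB
  have hC := hasPair_step2 (G' := ForbC) (fun x b c e hC h1 h2 => hC e h1 h2) hB
  rwa [show k + (r + 1) + 2 = k + (r + 2) + 1 by ring]

lemma not_hasPair_base : ¬ HasPair ForbC [0] := by
  rintro ⟨u, v, hu, hv, h⟩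
  have hz : ∀ w : List (Fin 3), w <:+: [0] → w.count 1 = 0 ∧ w.count 2 = 0 := by
    intro w hw
    have h1 := hw.sublist.count_le (1 : Fin 3)
    have h2 := hw.sublist.count_le (2 : Fin 3)
    simp at h1 h2
    simp [List.count_eq_zero, h1, h2]
  obtain ⟨hu1, hu2⟩ := hz u hu
  obtain ⟨hv1, hv2⟩ := hz v hv
  rw [hu1, hu2, hv1, hv2] at h
  have := (h 0 (by norm_num) (by norm_num)).1
  norm_num at this

/-- Corollary: for any sequence `(s_n)` of positive integers, any Arnoux-Rauzy
word whose directive sequence is `1^{s₀} 2 3 1^{s₁} 2 3 ⋯` (letters 1,2,3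
written as `0,1,2 : Fin 3`) is `2`-balanced; in particular there are
`2`-balanced Arnoux-Rauzy words with unbounded weak partial quotients. -/
theorem two_balanced_with_unbounded_partial_quotients
    (s : ℕ → ℕ) (hs : ∀ n, 1 ≤ s n) (ω dir : ℕ → Fin 3) (hAR : IsAR ω dir)
    (T : ℕ → ℕ) (hT0 : T 0 = 0) (hTs : ∀ n, T (n + 1) = T n + s n + 2)
    (hdir : ∀ n r, r < s n + 2 →
      dir (T n + r) = if r < s n then 0 else if r = s n then 1 else 2) :
    IsBalanced 2 ω := by
  have hTmono : ∀ n K, n ≤ K → T n ≤ T K := by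
    intro n K h
    induction K, h using Nat.le_induction with
    | base => exact le_rfl
    | succ K _ ih => have := hTs K; omega
  have hTn : ∀ n, n ≤ T n := by
    intro n
    induction n with
    | zero => omega
    | succ n ih => have := hTs n; omega
  have hstep : ∀ K n, n ≤ K → HasPair ForbC (levelWord dir 0 (T K)) →
      HasPair ForbC (levelWord dir (T n) (T K - T n)) := by
    intro K n
    induction n with
    | zero => intro _ h; simpa [hT0] using h
    | succ n ih =>
      intro hn h
      have hp := ih (by omega) h
      obtain ⟨r, hr⟩ : ∃ r, s n = r + 1 := ⟨s n - 1, by have := hs n; omega⟩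
      have hm := hTmono (n + 1) K hn
      have hT := hTs n
      rw [hr] at hT
      rw [show T K - T n = r + 1 + 2 + (T K - T (n + 1)) by omega] at hp
      have := hasPair_block dir (T K - T (n + 1)) (T n) r ?_ ?_ ?_ hp
      · rwa [← hT] at this
      · intro t ht
        rw [hdir n t (by omega), if_pos (by omega)]
      · rw [hdir n (r + 1) (by omega), if_neg (by omega), if_pos (by omega)]
      · rw [hdir n (r + 2) (by omega), if_neg (by omega), if_neg (by omega)]
  intro u v hu hv hlen j
  obtain ⟨n, hn⟩ := (hAR.2 u).1 hu
  obtain ⟨m, hm⟩ := (hAR.2 v).1 hv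
  by_contra hcon
  have hK := hTn (max n m)
  have hu' : u <:+: levelWord dir 0 (T (max n m)) := by
    rw [← ARword_eq]
    exact hn.trans (ARword_mono dir (by omega)).isInfix
  have hv' : v <:+: levelWord dir 0 (T (max n m)) := by
    rw [← ARword_eq]
    exact hm.trans (ARword_mono dir (by omega)).isInfix
  have hC : HasPair ForbC (levelWord dir 0 (T (max n m))) := by
    refine ⟨u, v, hu', hv', forbC_start ?_ ?_⟩
    · rw [length_eq_counts, length_eq_counts v] at hlen
      omega
    · intro hb
      apply hcon
      rw [abs_le]
      fin_cases j <;> simp <;> omega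
  have := hstep _ _ le_rfl hC
  rw [Nat.sub_self] at this
  exact not_hasPair_base (by simpa [levelWord] using this)
end

section
/- Let ω be an Arnoux-Rauzy word over {1,2,3} whose directive sequence starts with a word in the language {1,3}^* 1 2^* 1 2 {1,2} (a word over {1,3}, then 1, then a block of 2's, then 1, 2, and one letter from {1,2}). Then ω is not 2-balanced: there exist factors u, v of ω with |u| = |v| and ||u|_j − |v|_j| ≥ 3 for some letter j. -/
/-- `σ_{dir k} ⋯ σ_{dir (k+n-1)} (1)`. -/
def tailWord (dir : ℕ → Fin 3) : ℕ → ℕ → List (Fin 3)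
  | _, 0 => [0]
  | k, n + 1 => sigmaSub (dir k) (tailWord dir (k + 1) n)

/-- Language of the shifted directive sequence. -/
def TailLang (dir : ℕ → Fin 3) (k : ℕ) (u : List (Fin 3)) : Prop :=
  ∃ n, u <:+: tailWord dir k n

lemma tailWord_eq (dir : ℕ → Fin 3) (n : ℕ) : ∀ k,
    ((List.range' k n).map dir).foldr sigmaSub [0] = tailWord dir k n := by
  induction n with
  | zero => intro k; simp [tailWord]
  | succ n ih => intro k; simp [tailWord, List.range'_succ, ih]

lemma sigmaSub_append (i : Fin 3) (u v : List (Fin 3)) :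
    sigmaSub i (u ++ v) = sigmaSub i u ++ sigmaSub i v := by
  simp [sigmaSub]

lemma sigmaSub_singleton_last (i x : Fin 3) : ∃ s, sigmaSub i [x] = s ++ [i] := by
  by_cases h : x = i
  · exact ⟨[], by simp [sigmaSub, h]⟩
  · exact ⟨[x], by simp [sigmaSub, h]⟩

lemma sigmaSub_singleton_head (i x : Fin 3) : ∃ s, sigmaSub i [x] = x :: s := by
  by_cases h : x = i
  · exact ⟨[], by simp [sigmaSub, h]⟩
  · exact ⟨[i], by simp [sigmaSub, h]⟩

lemma sigmaSub_last (i : Fin 3) (u : List (Fin 3)) (hu : u ≠ []) :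
    ∃ s, sigmaSub i u = s ++ [i] := by
  obtain ⟨t, x, rfl⟩ := List.eq_nil_or_concat u |>.resolve_left hu
  obtain ⟨s, hs⟩ := sigmaSub_singleton_last i x
  exact ⟨sigmaSub i t ++ s, by simp [sigmaSub_append, hs]⟩

lemma count_sigmaSub (i j : Fin 3) (u : List (Fin 3)) :
    (sigmaSub i u).count j = if j = i then u.length else u.count j := by
  induction u with
  | nil => simp [sigmaSub]
  | cons a u ih =>
    have : sigmaSub i (a :: u) = sigmaSub i [a] ++ sigmaSub i u :=
      sigmaSub_append i [a] u
    rw [this, List.count_append, ih]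
    by_cases h : a = i
    · subst h
      by_cases hj : j = a
      · subst hj; simp [sigmaSub]; omega
      · simp [sigmaSub, hj, List.count_cons, Ne.symm hj]
    · by_cases hj : j = i
      · subst hj; simp [sigmaSub, h]; omega
      · simp [sigmaSub, h, hj, List.count_cons, Ne.symm hj]; omega

lemma TailLang.mono {dir : ℕ → Fin 3} {k : ℕ} {u v : List (Fin 3)}
    (h : TailLang dir k v) (huv : u <:+: v) : TailLang dir k u := by
  obtain ⟨n, hn⟩ := h
  exact ⟨n, huv.trans hn⟩

lemma TailLang.sigma {dir : ℕ → Fin 3} {k : ℕ} {u : List (Fin 3)}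
    (h : TailLang dir (k + 1) u) : TailLang dir k (sigmaSub (dir k) u) := by
  obtain ⟨n, s, t, hn⟩ := h
  exact ⟨n + 1, sigmaSub (dir k) s, sigmaSub (dir k) t, by
    simp [tailWord, ← hn, sigmaSub_append]⟩

/-- Every letter occurs infinitely often. -/
def Inf3 (dir : ℕ → Fin 3) : Prop := ∀ a : Fin 3, ∀ m : ℕ, ∃ n, m ≤ n ∧ dir n = a

/-- Backward induction: a property that goes from `k+1` to `k`. -/
lemma back_ind (Q : ℕ → Prop) (hs : ∀ k, Q (k + 1) → Q k) {k n : ℕ} (hkn : k ≤ n)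
    (h : Q n) : Q k := by
  induction hkn with
  | refl => exact h
  | step _ ih => exact ih (hs _ h)

lemma letter_mem {dir : ℕ → Fin 3} (hd : Inf3 dir) (a : Fin 3) (k : ℕ) :
    TailLang dir k [a] := by
  obtain ⟨n, hkn, hn⟩ := hd a k
  refine back_ind (fun k => TailLang dir k [a]) ?_ hkn ?_
  · intro k h
    obtain ⟨s, hs⟩ := sigmaSub_singleton_head (dir k) a
    exact h.sigma.mono ⟨[], s, by simp [hs]⟩
  · have h0 : TailLang dir (n + 1) [0] := ⟨0, by simp [tailWord]⟩
    obtain ⟨s, hs⟩ := sigmaSub_singleton_last (dir n) 0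
    exact h0.sigma.mono ⟨s, [], by rw [hs, hn]; simp⟩

lemma pair_mem {dir : ℕ → Fin 3} (hd : Inf3 dir) (k : ℕ) :
    ∃ x, TailLang dir k [x, 0] := by
  obtain ⟨n, hkn, hn⟩ := hd 0 k
  refine back_ind (fun k => ∃ x, TailLang dir k [x, 0]) ?_ hkn ?_
  · rintro k ⟨x, h⟩
    obtain ⟨s, hs⟩ := sigmaSub_singleton_head (dir k) 0
    obtain ⟨t, ht⟩ := sigmaSub_singleton_last (dir k) x
    refine ⟨dir k, h.sigma.mono ⟨t, s, ?_⟩⟩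
    have := sigmaSub_append (dir k) [x] [0]
    rw [hs, ht] at this
    simpa using this.symm
  · refine ⟨1, ?_⟩
    have := (letter_mem hd 1 (n + 1)).sigma
    simpa [hn, sigmaSub] using this

lemma ext_tailWord {dir : ℕ → Fin 3} (hd : Inf3 dir) (n : ℕ) : ∀ k,
    ∃ x, TailLang dir k (x :: tailWord dir k n) := by
  induction n with
  | zero => intro k; exact pair_mem hd k
  | succ n ih =>
    intro k
    obtain ⟨x, hx⟩ := ih (k + 1)
    obtain ⟨t, ht⟩ := sigmaSub_singleton_last (dir k) x
    refine ⟨dir k, hx.sigma.mono ⟨t, [], ?_⟩⟩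
    have := sigmaSub_append (dir k) [x] (tailWord dir (k + 1) n)
    rw [ht] at this
    simpa [tailWord] using this.symm

lemma left_ext {dir : ℕ → Fin 3} (hd : Inf3 dir) {k : ℕ} {u : List (Fin 3)}
    (h : TailLang dir k u) : ∃ x, TailLang dir k (x :: u) := by
  obtain ⟨n, s, t, hn⟩ := h
  obtain ⟨x, hx⟩ := ext_tailWord hd n k
  obtain ⟨s', y, hy⟩ := List.eq_nil_or_concat (x :: s) |>.resolve_left (by simp)
  refine ⟨y, hx.mono ⟨s', t, ?_⟩⟩
  have : x :: tailWord dir k n = (x :: s) ++ u ++ t := by simp [← hn]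
  rw [this, hy]; simp

lemma sigma_ext {dir : ℕ → Fin 3} (hd : Inf3 dir) {k : ℕ} {u : List (Fin 3)}
    (h : TailLang dir (k + 1) u) : TailLang dir k (dir k :: sigmaSub (dir k) u) := by
  obtain ⟨x, hx⟩ := left_ext hd h
  obtain ⟨t, ht⟩ := sigmaSub_singleton_last (dir k) x
  refine hx.sigma.mono ⟨t, [], ?_⟩
  have := sigmaSub_append (dir k) [x] u
  rw [ht] at this
  simpa using this.symm

/-- The image of `u` with its length increased by `e ∈ {-1,0,1}` using the letter `dir k`. -/
lemma one_side {dir : ℕ → Fin 3} (hd : Inf3 dir) {k : ℕ} {u : List (Fin 3)}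
    (h : TailLang dir (k + 1) u) (hu : u ≠ []) (e : ℤ) (he : -1 ≤ e ∧ e ≤ 1) :
    ∃ w, TailLang dir k w ∧ ∀ j, (w.count j : ℤ) =
      if j = dir k then (u.length : ℤ) + e else (u.count j : ℤ) := by
  obtain rfl | rfl | rfl : e = -1 ∨ e = 0 ∨ e = 1 := by omega
  · obtain ⟨s, hs⟩ := sigmaSub_last (dir k) u hu
    refine ⟨s, h.sigma.mono ⟨[], [dir k], by simp [hs]⟩, fun j => ?_⟩
    have := count_sigmaSub (dir k) j u
    rw [hs, List.count_append] at this
    by_cases hj : j = dir k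
    · subst hj; simp at this ⊢; omega
    · simp [hj, List.count_cons, Ne.symm hj] at this ⊢; omega
  · refine ⟨_, h.sigma, fun j => ?_⟩
    rw [count_sigmaSub]; split_ifs <;> simp
  · refine ⟨_, sigma_ext hd h, fun j => ?_⟩
    rw [List.count_cons, count_sigmaSub]
    by_cases hj : j = dir k
    · subst hj; simp
    · simp [hj, Ne.symm hj]

/-- There are two factors with the given differences of letter counts. -/
def HasDiff (dir : ℕ → Fin 3) (k : ℕ) (x y z : ℤ) : Prop :=
  ∃ u v, TailLang dir k u ∧ TailLang dir k v ∧ (u.count 0 : ℤ) - v.count 0 = x ∧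
    (u.count 1 : ℤ) - v.count 1 = y ∧ (u.count 2 : ℤ) - v.count 2 = z

lemma HasDiff.neg {dir : ℕ → Fin 3} {k : ℕ} {x y z : ℤ} (h : HasDiff dir k x y z) :
    HasDiff dir k (-x) (-y) (-z) := by
  obtain ⟨u, v, hu, hv, h0, h1, h2⟩ := h
  exact ⟨v, u, hv, hu, by omega, by omega, by omega⟩

lemma HasDiff.step {dir : ℕ → Fin 3} (hd : Inf3 dir) {k : ℕ} {x y z : ℤ}
    (h : HasDiff dir (k + 1) x y z) (hpos : 0 < x ∨ 0 < y ∨ 0 < z)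
    (hneg : x < 0 ∨ y < 0 ∨ z < 0) (e : ℤ) (he : -2 ≤ e ∧ e ≤ 2) :
    HasDiff dir k (if dir k = 0 then x + y + z + e else x)
      (if dir k = 1 then x + y + z + e else y)
      (if dir k = 2 then x + y + z + e else z) := by
  obtain ⟨u, v, hu, hv, h0, h1, h2⟩ := h
  have hu' : u ≠ [] := by rintro rfl; simp at h0 h1 h2; omega
  have hv' : v ≠ [] := by rintro rfl; simp at h0 h1 h2; omega
  obtain ⟨e1, e2, h1e, h2e, hee⟩ : ∃ e1 e2 : ℤ, (-1 ≤ e1 ∧ e1 ≤ 1) ∧ (-1 ≤ e2 ∧ e2 ≤ 1) ∧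
      e = e1 - e2 :=
    ⟨e - e / 2, -(e / 2), by omega, by omega, by omega⟩
  obtain ⟨u', hLu, hcu⟩ := one_side hd hu hu' e1 h1e
  obtain ⟨v', hLv, hcv⟩ := one_side hd hv hv' e2 h2e
  have lu := length_eq_counts u
  have lv := length_eq_counts v
  refine ⟨u', v', hLu, hLv, ?_, ?_, ?_⟩ <;> rw [hcu, hcv] <;> simp only [eq_comm (b := dir k)] <;>
    split_ifs <;> omega

lemma HasDiff.step0 {dir : ℕ → Fin 3} (hd : Inf3 dir) {k : ℕ} {x y z : ℤ}
    (h : HasDiff dir (k + 1) x y z) (hk : dir k = 0) (x' : ℤ)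
    (hpos : 0 < x ∨ 0 < y ∨ 0 < z) (hneg : x < 0 ∨ y < 0 ∨ z < 0)
    (hx : -2 ≤ x' - (x + y + z) ∧ x' - (x + y + z) ≤ 2) : HasDiff dir k x' y z := by
  simpa [hk] using h.step hd hpos hneg _ hx

lemma HasDiff.step1 {dir : ℕ → Fin 3} (hd : Inf3 dir) {k : ℕ} {x y z : ℤ}
    (h : HasDiff dir (k + 1) x y z) (hk : dir k = 1) (y' : ℤ)
    (hpos : 0 < x ∨ 0 < y ∨ 0 < z) (hneg : x < 0 ∨ y < 0 ∨ z < 0)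
    (hx : -2 ≤ y' - (x + y + z) ∧ y' - (x + y + z) ≤ 2) : HasDiff dir k x y' z := by
  simpa [hk] using h.step hd hpos hneg _ hx

lemma HasDiff.step2 {dir : ℕ → Fin 3} (hd : Inf3 dir) {k : ℕ} {x y z : ℤ}
    (h : HasDiff dir (k + 1) x y z) (hk : dir k = 2) (z' : ℤ)
    (hpos : 0 < x ∨ 0 < y ∨ 0 < z) (hneg : x < 0 ∨ y < 0 ∨ z < 0)
    (hx : -2 ≤ z' - (x + y + z) ∧ z' - (x + y + z) ≤ 2) : HasDiff dir k x y z' := by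
  simpa [hk] using h.step hd hpos hneg _ hx

lemma fin3_cases (a : Fin 3) : a = 0 ∨ a = 1 ∨ a = 2 := by
  fin_cases a <;> simp

/-- A difference vector that can be kept under every substitution. -/
lemma HasDiff.persist {dir : ℕ → Fin 3} (hd : Inf3 dir) {k n : ℕ} (hkn : k ≤ n) {x y z : ℤ}
    (hpos : 0 < x ∨ 0 < y ∨ 0 < z) (hneg : x < 0 ∨ y < 0 ∨ z < 0)
    (h0 : -2 ≤ y + z ∧ y + z ≤ 2) (h1 : -2 ≤ x + z ∧ x + z ≤ 2)
    (h2 : -2 ≤ x + y ∧ x + y ≤ 2)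
    (h : HasDiff dir n x y z) : HasDiff dir k x y z := by
  refine back_ind (fun k => HasDiff dir k x y z) (fun k hk => ?_) hkn h
  rcases fin3_cases (dir k) with hc | hc | hc
  · exact hk.step0 hd hc x hpos hneg (by omega)
  · exact hk.step1 hd hc y hpos hneg (by omega)
  · exact hk.step2 hd hc z hpos hneg (by omega)

lemma hasDiff_base {dir : ℕ → Fin 3} (hd : Inf3 dir) (k : ℕ) : HasDiff dir k 0 1 (-1) :=
  ⟨[1], [2], letter_mem hd 1 k, letter_mem hd 2 k, by simp, by simp, by simp⟩

lemma hasDiff_A {dir : ℕ → Fin 3} (hd : Inf3 dir) (k : ℕ) : HasDiff dir k 1 1 (-2) := by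
  obtain ⟨r, hkr, hr⟩ := hd 0 k
  obtain ⟨t, hrt, ht⟩ := hd 2 (r + 1)
  have a1 := (hasDiff_base hd (t + 1)).step2 hd ht (-2) (by omega) (by omega) (by omega)
  have a2 := a1.persist hd hrt (by omega) (by omega) (by omega) (by omega) (by omega)
  have a3 := a2.step0 hd hr 1 (by omega) (by omega) (by omega)
  exact a3.persist hd hkr (by omega) (by omega) (by omega) (by omega) (by omega)

lemma hasDiff_B {dir : ℕ → Fin 3} (hd : Inf3 dir) (k : ℕ) : HasDiff dir k (-1) 2 (-1) := by
  obtain ⟨r, hkr, hr⟩ := hd 0 k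
  obtain ⟨t, hrt, ht⟩ := hd 1 (r + 1)
  have a1 := (hasDiff_base hd (t + 1)).step1 hd ht 2 (by omega) (by omega) (by omega)
  have a2 := a1.persist hd hrt (by omega) (by omega) (by omega) (by omega) (by omega)
  have a3 := a2.step0 hd hr (-1) (by omega) (by omega) (by omega)
  exact a3.persist hd hkr (by omega) (by omega) (by omega) (by omega) (by omega)

lemma hasDiff_C {dir : ℕ → Fin 3} (hd : Inf3 dir) (n : ℕ) : ∀ k, dir (k + n) ≠ 0 →
    ∃ x : ℤ, (x = 1 ∨ x = -1) ∧ HasDiff dir k x 2 (-2) := by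
  induction n with
  | zero =>
    intro k hk
    rcases fin3_cases (dir k) with hc | hc | hc
    · exact absurd hc hk
    · exact ⟨1, by simp, (hasDiff_A hd (k + 1)).step1 hd hc 2 (by omega) (by omega) (by omega)⟩
    · exact ⟨-1, by simp, (hasDiff_B hd (k + 1)).step2 hd hc (-2) (by omega) (by omega) (by omega)⟩
  | succ n ih =>
    intro k hk
    rcases fin3_cases (dir k) with hc | hc | hc
    · obtain ⟨x, hx, h⟩ := ih (k + 1) (by rwa [show k + 1 + n = k + (n + 1) by omega])
      exact ⟨x, hx, h.step0 hd hc x (by omega) (by omega) (by omega)⟩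
    · exact ⟨1, by simp, (hasDiff_A hd (k + 1)).step1 hd hc 2 (by omega) (by omega) (by omega)⟩
    · exact ⟨-1, by simp, (hasDiff_B hd (k + 1)).step2 hd hc (-2) (by omega) (by omega) (by omega)⟩

/-- `dir` reads `l` starting at index `k`. -/
def Reads (dir : ℕ → Fin 3) : ℕ → List (Fin 3) → Prop
  | _, [] => True
  | k, a :: l => dir k = a ∧ Reads dir (k + 1) l

lemma reads_of_map (dir : ℕ → Fin 3) (l : List (Fin 3)) : ∀ k,
    (List.range' k l.length).map dir = l → Reads dir k l := by
  induction l with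
  | nil => intro k _; trivial
  | cons a l ih =>
    intro k h
    simp only [List.length_cons, List.range'_succ, List.map_cons, List.cons.injEq] at h
    exact ⟨h.1, ih _ h.2⟩

lemma reads_append (dir : ℕ → Fin 3) (l m : List (Fin 3)) : ∀ k,
    Reads dir k (l ++ m) → Reads dir k l ∧ Reads dir (k + l.length) m := by
  induction l with
  | nil => intro k h; exact ⟨trivial, h⟩
  | cons a l ih =>
    intro k h
    obtain ⟨h1, h2⟩ := ih _ h.2
    refine ⟨⟨h.1, h1⟩, ?_⟩
    rwa [List.length_cons, show k + (l.length + 1) = k + 1 + l.length by omega]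

lemma reads_persist (dir : ℕ → Fin 3) (Q : ℕ → Prop) (S : Fin 3 → Prop)
    (hs : ∀ k, S (dir k) → Q (k + 1) → Q k) (l : List (Fin 3)) (hl : ∀ a ∈ l, S a) : ∀ k,
    Reads dir k l → Q (k + l.length) → Q k := by
  induction l with
  | nil => intro k _ h; exact h
  | cons a l ih =>
    intro k h hq
    refine hs k (h.1 ▸ hl a (by simp)) (ih (fun b hb => hl b (by simp [hb])) _ h.2 ?_)
    rwa [List.length_cons, show k + (l.length + 1) = k + 1 + l.length by omega] at hq

/-- Theorem 3: if the directive sequence of an Arnoux-Rauzy word `ω` starts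
with a word in the language `{1,3}* 1 2* 1 2 {1,2}` (letters 1,2,3 written as
`0,1,2 : Fin 3`), then `ω` is not `2`-balanced: it has two equal-length factors
whose counts of some letter differ by at least 3. -/
theorem not_two_balanced_of_prefix
    (ω dir : ℕ → Fin 3) (hAR : IsAR ω dir)
    (p q : List (Fin 3)) (c : Fin 3)
    (hp : ∀ a ∈ p, a = 0 ∨ a = 2) (hq : ∀ a ∈ q, a = 1) (hc : c = 0 ∨ c = 1)
    (hpre : (List.range (p ++ [0] ++ q ++ [0, 1, c]).length).map dir
      = p ++ [0] ++ q ++ [0, 1, c]) :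
    ∃ u v : List (Fin 3), FactorOf ω u ∧ FactorOf ω v ∧ u.length = v.length ∧
      ∃ j : Fin 3, 3 ≤ |(u.count j : ℤ) - v.count j| := by
  have hd : Inf3 dir := hAR.1
  rw [List.range_eq_range'] at hpre
  have hR := reads_of_map dir _ 0 hpre
  rw [List.append_assoc, List.append_assoc] at hR
  obtain ⟨hRp, hR⟩ := reads_append dir _ _ _ hR
  obtain ⟨hR0, hR⟩ := (show dir (0 + p.length) = 0 ∧
    Reads dir (0 + p.length + 1) (q ++ [0, 1, c]) from hR)
  obtain ⟨hRq, hRa, hRb, hRc, -⟩ := reads_append dir _ _ _ hR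
  generalize hK : 0 + p.length + 1 + q.length = K at *
  have s1 : HasDiff dir (K + 1 + 1) 1 2 (-2) := by
    rcases hc with rfl | rfl
    · obtain ⟨n, hn, hn1⟩ := hd 1 (K + 1 + 1 + 1)
      obtain ⟨d, rfl⟩ := Nat.exists_eq_add_of_le hn
      obtain ⟨x, hx, h⟩ := hasDiff_C hd d (K + 1 + 1 + 1) (by simp [hn1])
      exact h.step0 hd hRc 1 (by omega) (by omega) (by omega)
    · exact (hasDiff_A hd _).step1 hd hRc 2 (by omega) (by omega) (by omega)
  have s2 := s1.step1 hd hRb 3 (by omega) (by omega) (by omega)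
  have s3 := s2.step0 hd hRa 0 (by omega) (by omega) (by omega)
  rw [← hK] at s3
  have s4 := reads_persist dir (fun k => HasDiff dir k 0 3 (-2)) (fun a => a = 1)
    (fun k hk h => h.step1 hd hk 3 (by omega) (by omega) (by omega)) q hq _ hRq s3
  have s5 := HasDiff.step0 hd s4 hR0 (-1) (by omega) (by omega) (by omega)
  have s6 := reads_persist dir (fun k => HasDiff dir k (-1) 3 (-2)) (fun a => a = 0 ∨ a = 2)
    (fun k hk h => hk.elim
      (fun hk => h.step0 hd hk (-1) (by omega) (by omega) (by omega))
      (fun hk => h.step2 hd hk (-2) (by omega) (by omega) (by omega))) p hp _ hRp s5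
  obtain ⟨u, v, ⟨n, hu⟩, ⟨m, hv⟩, h0, h1, h2⟩ := s6
  have hW : ∀ n, ARword dir n = tailWord dir 0 n := fun n => by
    rw [← tailWord_eq, ARword, List.range_eq_range']
  refine ⟨u, v, (hAR.2 u).2 ⟨n, by rwa [hW]⟩, (hAR.2 v).2 ⟨m, by rwa [hW]⟩, ?_, 1, ?_⟩
  · have := length_eq_counts u
    have := length_eq_counts v
    omega
  · rw [h1]; norm_num
end
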